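/- Let Q be the mixture (1/2)δ₀ + (1/2)P where P has density (1/π)·1/(x(1+log²x)) on (0,∞). For the exponential family generated by Q (with canonical parameters β < 0), the Jeffreys integral ∫_{−∞}^0 I_β^{1/2} dβ is infinite. -/

import Mathlib

open scoped ENNReal NNReal
open MeasureTheory Real Set Filter Topology Asymptotics ProbabilityTheory

noncomputable section

/-- Partition function of the exponential family generated by `Q`. -/
def Z (Q : Measure ℝ) (β : ℝ) : ℝ≥0∞ := ∫⁻ x, ENNReal.ofReal (Real.exp (β * x)) ∂Q

/-- Canonical parameter space. -/
def Γcan (Q : Measure ℝ) : Set ℝ := {β | Z Q β < ⊤}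

/-- The member of the exponential family with canonical parameter `β`:
`dP_β/dQ = e^{βx}/Z(β)`. -/
def Pexp (Q : Measure ℝ) (β : ℝ) : Measure ℝ :=
  Q.withDensity (fun x => ENNReal.ofReal (Real.exp (β * x)) / Z Q β)

/-- Log-partition function. -/
def ψ (Q : Measure ℝ) (β : ℝ) : ℝ := Real.log (Z Q β).toReal

open Classical in
/-- Kullback–Leibler divergence (in nats), valued in `ℝ≥0∞`. -/
def KL (P Q' : Measure ℝ) : ℝ≥0∞ :=
  if P ≪ Q' ∧ Integrable (fun x => Real.log (P.rnDeriv Q' x).toReal) P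
  then ENNReal.ofReal (∫ x, Real.log (P.rnDeriv Q' x).toReal ∂P) else ⊤

/-- `Q` is supported on a half-line bounded below (left-truncated family). -/
def LeftTruncated (Q : Measure ℝ) : Prop := ∃ a : ℝ, ∀ᵐ x ∂Q, a ≤ x
/-- The exponentiated Cauchy distribution. -/
def Pcauchyexp : Measure ℝ :=
  volume.withDensity (fun x =>
    if 0 < x then ENNReal.ofReal (1 / (π * (x * (1 + Real.log x ^ 2)))) else 0)

/-- The mixture (1/2)δ₀ + (1/2)P of a point mass at 0 and the exponentiated
Cauchy distribution. -/
def Qmix : Measure ℝ := (1/2 : ℝ≥0∞) • Measure.dirac 0 + (1/2 : ℝ≥0∞) • Pcauchyexp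


lemma dens_meas : Measurable (fun x : ℝ =>
    if 0 < x then ENNReal.ofReal (1 / (π * (x * (1 + Real.log x ^ 2)))) else 0) := by
  refine Measurable.ite measurableSet_Ioi ?_ measurable_const
  fun_prop

lemma dens_integrable :
    IntegrableOn (fun x : ℝ => 1 / (π * (x * (1 + Real.log x ^ 2)))) (Ioi 0) := by
  have hd : ∀ x ∈ Ioi (0:ℝ), HasDerivAt (Function.update (fun x : ℝ => π⁻¹ * arctan (Real.log x)) 0
      (π⁻¹ * (-(π / 2)))) (1 / (π * (x * (1 + Real.log x ^ 2)))) x := by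
    intro x hx
    have hx' : (0:ℝ) < x := hx
    have h1 : HasDerivAt (fun x : ℝ => π⁻¹ * arctan (Real.log x))
        (π⁻¹ * (1 / (1 + Real.log x ^ 2) * x⁻¹)) x :=
      ((Real.hasDerivAt_log hx'.ne').arctan).const_mul _
    have h2 : HasDerivAt (fun x : ℝ => π⁻¹ * arctan (Real.log x))
        (1 / (π * (x * (1 + Real.log x ^ 2)))) x := by
      convert h1 using 1
      have : (1 + Real.log x ^ 2) ≠ 0 := by positivity
      field_simp
    refine h2.congr_of_eventuallyEq ?_
    filter_upwards [isOpen_Ioi.mem_nhds hx] with y hy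
    have hy' : (0:ℝ) < y := hy
    simp [Function.update_of_ne hy'.ne']
  refine integrableOn_Ioi_deriv_of_nonneg (l := π⁻¹ * (π / 2)) ?_ hd ?_ ?_
  · rw [continuousWithinAt_update_same]
    have : Ici (0:ℝ) \ {0} = Ioi 0 := by
      ext x; simp [lt_iff_le_and_ne, eq_comm]
    rw [this]
    refine Tendsto.const_mul _ ?_
    have h := (tendsto_arctan_atBot.mono_right nhdsWithin_le_nhds).comp Real.tendsto_log_nhdsGT_zero
    exact h
  · intro x hx
    have hx' : (0:ℝ) < x := hx
    positivity
  · have h : Tendsto (fun x : ℝ => π⁻¹ * arctan (Real.log x)) atTop (𝓝 (π⁻¹ * (π / 2))) :=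
      ((tendsto_arctan_atTop.mono_right nhdsWithin_le_nhds).comp Real.tendsto_log_atTop).const_mul _
    refine h.congr' ?_
    filter_upwards [eventually_gt_atTop 0] with y hy
    simp [Function.update_of_ne hy.ne']

instance : IsFiniteMeasure Pcauchyexp := by
  refine ⟨?_⟩
  unfold Pcauchyexp
  rw [withDensity_apply _ MeasurableSet.univ, Measure.restrict_univ]
  have h : (fun x : ℝ =>
    if 0 < x then ENNReal.ofReal (1 / (π * (x * (1 + Real.log x ^ 2)))) else 0)
      = (Ioi (0:ℝ)).indicator (fun x => ENNReal.ofReal (1 / (π * (x * (1 + Real.log x ^ 2))))) := by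
    ext x; simp [indicator]
  rw [h, lintegral_indicator measurableSet_Ioi]
  exact dens_integrable.lintegral_lt_top

instance : IsFiniteMeasure Qmix := by
  refine ⟨?_⟩
  unfold Qmix
  simp only [Measure.add_apply, Measure.smul_apply, smul_eq_mul]
  refine ENNReal.add_lt_top.2 ⟨ENNReal.mul_lt_top (by simp) (measure_lt_top _ _),
    ENNReal.mul_lt_top (by simp) (measure_lt_top _ _)⟩

lemma P_nonneg : ∀ᵐ x ∂Pcauchyexp, 0 ≤ x := by
  rw [ae_iff]
  unfold Pcauchyexp
  have hs : MeasurableSet {x : ℝ | ¬ 0 ≤ x} := by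
    simp only [not_le]; exact measurableSet_Iio
  rw [withDensity_apply _ hs, setLIntegral_congr_fun (g := fun _ => 0) hs]
  · simp
  · intro x hx
    have : ¬ (0 < x) := fun h => hx h.le
    simp [this]

lemma integrable_P (v : ℝ) (hv : v < 0) : Integrable (fun x => Real.exp (v * x)) Pcauchyexp := by
  refine Integrable.mono' (integrable_const 1) (by fun_prop) ?_
  filter_upwards [P_nonneg] with x hx
  rw [Real.norm_eq_abs, abs_of_pos (Real.exp_pos _)]
  exact Real.exp_le_one_iff.2 (by nlinarith)

lemma mix_integrable {f : ℝ → ℝ} (hf : Integrable f Pcauchyexp) :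
    Integrable f Qmix := by
  unfold Qmix
  refine Integrable.add_measure ?_ ?_
  · refine Integrable.smul_measure ?_ (by simp)
    exact integrable_dirac (by simp)
  · exact hf.smul_measure (by simp)

lemma mix_integral {f : ℝ → ℝ} (hf : Integrable f Pcauchyexp) :
    ∫ x, f x ∂Qmix = f 0 / 2 + (∫ x, f x ∂Pcauchyexp) / 2 := by
  unfold Qmix
  rw [integral_add_measure, integral_smul_measure, integral_smul_measure, integral_dirac]
  · simp; ring
  · refine Integrable.smul_measure ?_ (by simp)
    exact integrable_dirac (by simp)
  · exact hf.smul_measure (by simp)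

lemma interior_P (v : ℝ) (hv : v < 0) : v ∈ interior (integrableExpSet id Pcauchyexp) :=
  mem_interior.2 ⟨Iio 0, fun w hw => integrable_P w hw, isOpen_Iio, hv⟩

lemma interior_Q (v : ℝ) (hv : v < 0) : v ∈ interior (integrableExpSet id Qmix) :=
  mem_interior.2 ⟨Iio 0, fun w hw => mix_integrable (integrable_P w hw), isOpen_Iio, hv⟩

lemma psi_eq : ψ Qmix = cgf id Qmix := by
  ext β
  unfold ψ cgf mgf Z
  rw [integral_eq_lintegral_of_nonneg_ae (ae_of_all _ fun x => (Real.exp_pos _).le) (by fun_prop)]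
  rfl

lemma P_lower (b : ℝ) (hb : 2 ≤ b) :
    1 / (2 * π * (1 + Real.log b ^ 2)) ≤ Pcauchyexp.real (Icc (1 / b) (2 / b)) := by
  have hb0 : 0 < b := by linarith
  have key : ENNReal.ofReal (1 / (2 * π * (1 + Real.log b ^ 2))) ≤
      Pcauchyexp (Icc (1 / b) (2 / b)) := by
    unfold Pcauchyexp
    rw [withDensity_apply _ measurableSet_Icc]
    calc ENNReal.ofReal (1 / (2 * π * (1 + Real.log b ^ 2)))
        = ∫⁻ x in Icc (1 / b) (2 / b), ENNReal.ofReal (1 / (π * (2 / b * (1 + Real.log b ^ 2)))) := by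
          rw [setLIntegral_const, Real.volume_Icc, ← ENNReal.ofReal_mul (by positivity)]
          congr 1
          have : (1 + Real.log b ^ 2) ≠ 0 := by positivity
          field_simp
          try ring
      _ ≤ _ := by
          refine setLIntegral_mono dens_meas ?_
          intro x hx
          have hx0 : 0 < x := lt_of_lt_of_le (by positivity) hx.1
          rw [if_pos hx0]
          refine ENNReal.ofReal_le_ofReal ?_
          have h1 : Real.log x ≤ 0 := by
            refine Real.log_nonpos hx0.le (hx.2.trans ?_)
            rw [div_le_one hb0]; exact hb
          have h2 : -Real.log b ≤ Real.log x := by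
            rw [← Real.log_inv, ← one_div]
            exact Real.log_le_log (by positivity) hx.1
          have h3 : Real.log x ^ 2 ≤ Real.log b ^ 2 := by nlinarith
          have h4 := hx.2
          gcongr
  rw [measureReal_def]
  exact (ENNReal.ofReal_le_iff_le_toReal (measure_ne_top _ _)).1 key

lemma second_lower (b : ℝ) (hb : 2 ≤ b) :
    Real.exp (-2) / (2 * π * (b ^ 2 * (1 + Real.log b ^ 2))) ≤
      ∫ x, x ^ 2 * Real.exp (-b * x) ∂Pcauchyexp := by
  have hb0 : 0 < b := by linarith
  have hint : Integrable (fun x : ℝ => x ^ 2 * Real.exp (-b * x)) Pcauchyexp :=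
    integrable_pow_mul_exp_of_mem_interior_integrableExpSet (interior_P (-b) (by linarith)) 2
  calc Real.exp (-2) / (2 * π * (b ^ 2 * (1 + Real.log b ^ 2)))
      = (1 / (2 * π * (1 + Real.log b ^ 2))) * ((1 / b) ^ 2 * Real.exp (-2)) := by
        have : (1 + Real.log b ^ 2) ≠ 0 := by positivity
        field_simp
    _ ≤ Pcauchyexp.real (Icc (1 / b) (2 / b)) * ((1 / b) ^ 2 * Real.exp (-2)) := by
        gcongr; exact P_lower b hb
    _ = ∫ x in Icc (1 / b) (2 / b), ((1 / b) ^ 2 * Real.exp (-2)) ∂Pcauchyexp := by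
        rw [setIntegral_const, smul_eq_mul]
    _ ≤ ∫ x in Icc (1 / b) (2 / b), x ^ 2 * Real.exp (-b * x) ∂Pcauchyexp := by
        refine setIntegral_mono_on (integrable_const _) hint.integrableOn measurableSet_Icc ?_
        intro x hx
        have h1 := hx.1
        have h2 := (le_div_iff₀ hb0).1 hx.2
        have : -2 ≤ -b * x := by linarith
        gcongr
    _ ≤ _ := setIntegral_le_integral hint (ae_of_all _ fun x => by positivity)

lemma info_lower : ∃ c : ℝ, 0 < c ∧ ∀ b : ℝ, 2 ≤ b →
    (c * (b * (1 + Real.log b))⁻¹) ^ 2 ≤ iteratedDeriv 2 (cgf id Qmix) (-b) := by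
  set K : ℝ := 1 / 2 + Pcauchyexp.real univ / 2 with hK
  have hKpos : 0 < K := by positivity
  refine ⟨Real.sqrt (Real.exp (-2) / (8 * π * K ^ 2)), by positivity, fun b hb => ?_⟩
  have hb0 : 0 < b := by linarith
  have hv : -b < 0 := by linarith
  have hlog : 0 ≤ Real.log b := Real.log_nonneg (by linarith)
  have i0 := integrable_P (-b) hv
  have i1 : Integrable (fun x : ℝ => x * Real.exp (-b * x)) Pcauchyexp := by
    simpa using integrable_pow_mul_exp_of_mem_interior_integrableExpSet (interior_P (-b) hv) 1
  have i2 : Integrable (fun x : ℝ => x ^ 2 * Real.exp (-b * x)) Pcauchyexp :=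
    integrable_pow_mul_exp_of_mem_interior_integrableExpSet (interior_P (-b) hv) 2
  have m0 := mix_integral i0
  have m1 := mix_integral i1
  have m2 := mix_integral i2
  have hlow := second_lower b hb
  set w := ∫ x, Real.exp (-b * x) ∂Pcauchyexp with hw
  set w1 := ∫ x, x * Real.exp (-b * x) ∂Pcauchyexp with hw1
  set w2 := ∫ x, x ^ 2 * Real.exp (-b * x) ∂Pcauchyexp with hw2
  have hw0 : 0 ≤ w := integral_nonneg fun x => (Real.exp_pos _).le
  have hw20 : 0 ≤ w2 := integral_nonneg fun x => by positivity
  have hwK : w ≤ Pcauchyexp.real univ := by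
    have : w ≤ ∫ x, (1:ℝ) ∂Pcauchyexp := by
      refine integral_mono_ae i0 (integrable_const 1) ?_
      filter_upwards [P_nonneg] with x hx
      exact Real.exp_le_one_iff.2 (by nlinarith)
    simpa using this
  have hCS : w1 ^ 2 ≤ w * w2 := by
    have hq : ∀ l : ℝ, 0 ≤ w * (l * l) + (-2 * w1) * l + w2 := by
      intro l
      have h : ∫ x, (x - l) ^ 2 * Real.exp (-b * x) ∂Pcauchyexp
          = w * (l * l) + (-2 * w1) * l + w2 := by
        have : (fun x : ℝ => (x - l) ^ 2 * Real.exp (-b * x)) = fun x =>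
          (l * l) * Real.exp (-b * x) + (-2 * l) * (x * Real.exp (-b * x))
            + x ^ 2 * Real.exp (-b * x) := by ext x; ring
        have i01 : Integrable (fun x : ℝ => (l * l) * Real.exp (-b * x)
            + (-2 * l) * (x * Real.exp (-b * x))) Pcauchyexp :=
          (i0.const_mul _).add (i1.const_mul _)
        rw [this, integral_add i01 i2,
          integral_add (i0.const_mul _) (i1.const_mul _), integral_const_mul, integral_const_mul]
        ring
      rw [← h]
      exact integral_nonneg fun x => by positivity
    have := discrim_le_zero hq
    unfold discrim at this
    nlinarith
  rw [iteratedDeriv_two_cgf (interior_Q (-b) hv), deriv_cgf (interior_Q (-b) hv)]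
  unfold mgf
  simp only [id]
  rw [m0, m1, m2]
  simp only [mul_zero, Real.exp_zero, zero_mul, ne_eq, OfNat.ofNat_ne_zero, not_false_eq_true,
    zero_pow, zero_div, zero_add]
  have hM : 0 < 1 / 2 + w / 2 := by positivity
  calc (Real.sqrt (Real.exp (-2) / (8 * π * K ^ 2)) * (b * (1 + Real.log b))⁻¹) ^ 2
      = (Real.exp (-2) / (2 * π * (b ^ 2 * (1 + Real.log b) ^ 2))) / (4 * K ^ 2) := by
        rw [mul_pow, Real.sq_sqrt (by positivity)]
        have : (1 + Real.log b) ≠ 0 := by positivity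
        field_simp
        norm_num
    _ ≤ (Real.exp (-2) / (2 * π * (b ^ 2 * (1 + Real.log b ^ 2)))) / (4 * K ^ 2) := by
        gcongr
        nlinarith
    _ ≤ w2 / (4 * (1 / 2 + w / 2) ^ 2) := by
        have : 1 / 2 + w / 2 ≤ K := by rw [hK]; linarith
        gcongr
    _ ≤ w2 / 2 / (1 / 2 + w / 2) - (w1 / 2 / (1 / 2 + w / 2)) ^ 2 := by
        have : w2 / 2 / (1 / 2 + w / 2) - (w1 / 2 / (1 / 2 + w / 2)) ^ 2
          = (w2 + (w * w2 - w1 ^ 2)) / (4 * (1 / 2 + w / 2) ^ 2) := by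
          field_simp
          ring
        rw [this]
        gcongr
        linarith

lemma not_int : ¬ IntegrableOn (fun x : ℝ => (-x * (1 + Real.log (-x)))⁻¹) (Iic (-2)) := by
  have hd : ∀ x : ℝ, x ≤ -2 → HasDerivAt (fun x : ℝ => Real.log (1 + Real.log (-x)))
      (x⁻¹ / (1 + Real.log (-x))) x := by
    intro x hx
    have hl : 0 ≤ Real.log (-x) := Real.log_nonneg (by linarith)
    have h1 : HasDerivAt (fun x : ℝ => 1 + Real.log (-x)) x⁻¹ x := by
      simp only [Real.log_neg_eq_log]
      exact (Real.hasDerivAt_log (by linarith)).const_add 1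
    exact h1.log (by positivity)
  refine not_integrableOn_of_tendsto_norm_atTop_of_deriv_isBigO_filter
    (f := fun x : ℝ => Real.log (1 + Real.log (-x))) atBot (Iic_mem_atBot _) ?_ ?_ ?_
  · filter_upwards [Iic_mem_atBot (-2)] with x hx using (hd x hx).differentiableAt
  · refine tendsto_norm_atTop_atTop.comp (Real.tendsto_log_atTop.comp ?_)
    exact tendsto_atTop_add_const_left _ _ (Real.tendsto_log_atTop.comp tendsto_neg_atBot_atTop)
  · refine IsBigO.of_bound 1 ?_
    filter_upwards [Iic_mem_atBot (-2)] with x hx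
    rw [(hd x hx).deriv]
    simp [div_eq_mul_inv, mul_comm]

/-- the Jeffreys integral of the exponential family generated by
Qmix over the canonical parameters β < 0 is infinite. -/
theorem jeffreys_infinite_for_mixture
    (ψ' I : ℝ → ℝ)
    (hd1 : ∀ β < (0 : ℝ), HasDerivAt (ψ Qmix) (ψ' β) β)
    (hd2 : ∀ β < (0 : ℝ), HasDerivAt ψ' (I β) β) :
    ∫⁻ β in Iio (0 : ℝ), ENNReal.ofReal (Real.sqrt (I β)) = ⊤ := by
  obtain ⟨c, hc, hI⟩ := info_lower
  have hIeq : ∀ β < (0:ℝ), I β = iteratedDeriv 2 (cgf id Qmix) β := by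
    intro β hβ
    rw [iteratedDeriv_succ, iteratedDeriv_one, ← psi_eq]
    have : deriv (ψ Qmix) =ᶠ[𝓝 β] ψ' := by
      filter_upwards [isOpen_Iio.mem_nhds hβ] with y hy using (hd1 y hy).deriv
    rw [this.deriv_eq, (hd2 β hβ).deriv]
  by_contra hne
  apply not_int
  have hmeas : Measurable (fun x : ℝ => (-x * (1 + Real.log (-x)))⁻¹) := by fun_prop
  have hci : IntegrableOn (fun x : ℝ => c * (-x * (1 + Real.log (-x)))⁻¹) (Iic (-2)) := by
    refine ⟨(hmeas.const_mul c).aestronglyMeasurable, ?_⟩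
    refine lt_of_le_of_lt ?_ (lt_top_iff_ne_top.2 hne)
    refine le_trans (setLIntegral_mono' measurableSet_Iic ?_)
      (lintegral_mono_set (s := Iic (-2)) (fun x (hx : x ≤ -2) => show x < 0 by linarith))
    intro x hx
    have hx' : x ≤ -2 := hx
    have hl : 0 ≤ Real.log (-x) := Real.log_nonneg (by linarith)
    have hnx : 0 < -x := by linarith
    have h0 : 0 ≤ c * (-x * (1 + Real.log (-x)))⁻¹ := by positivity
    rw [Real.enorm_of_nonneg h0]
    refine ENNReal.ofReal_le_ofReal (Real.le_sqrt_of_sq_le ?_)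
    rw [hIeq x (by linarith)]
    simpa using hI (-x) (by linarith)
  exact (integrable_const_mul_iff (IsUnit.mk0 c hc.ne') _).1 hci
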